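/- (Proposition 1 of the paper, instantiated for a wiretap BEC.) In the polar-secrecy-code-over-BEC setup, the mutual information security leakage satisfies I(U; Z) ≤ min( Σ_{i∈A∪B} C_i , k ). -/

import Mathlib

open scoped Classical

noncomputable section

/-- `p` is a probability mass function on the finite sample space `Ω`. -/
def IsPMF {Ω : Type} [Fintype Ω] (p : Ω → ℝ) : Prop :=
  (∀ ω, 0 ≤ p ω) ∧ ∑ ω, p ω = 1

/-- `P(X = x)`: the probability of the event `{X = x}` under the pmf `p`. -/
def prob {Ω : Type} [Fintype Ω] (p : Ω → ℝ) {α : Type} (X : Ω → α) (x : α) : ℝ :=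
  ∑ ω, if X ω = x then p ω else 0

/-- Shannon entropy of `X` in bits (logarithm base 2). -/
def entropy {Ω : Type} [Fintype Ω] (p : Ω → ℝ) {α : Type} [Fintype α] (X : Ω → α) : ℝ :=
  -∑ x, prob p X x * Real.logb 2 (prob p X x)

/-- Mutual information `I(X;Y) = H(X) + H(Y) - H((X,Y))` in bits. -/
def mutInfo {Ω : Type} [Fintype Ω] (p : Ω → ℝ) {α β : Type} [Fintype α] [Fintype β]
    (X : Ω → α) (Y : Ω → β) : ℝ :=
  entropy p X + entropy p Y - entropy p fun ω => (X ω, Y ω)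

/-- Conditional mutual information
`I(X;Y∣W) = H((X,W)) + H((Y,W)) - H((X,Y,W)) - H(W)` in bits. -/
def condMutInfo {Ω : Type} [Fintype Ω] (p : Ω → ℝ) {α β γ : Type}
    [Fintype α] [Fintype β] [Fintype γ] (X : Ω → α) (Y : Ω → β) (W : Ω → γ) : ℝ :=
  entropy p (fun ω => (X ω, W ω)) + entropy p (fun ω => (Y ω, W ω))
    - entropy p (fun ω => (X ω, Y ω, W ω)) - entropy p W

/-- Arıkan's 2×2 polarization kernel over `F_2`. -/
def Gmat : Matrix (Fin 2) (Fin 2) (ZMod 2) := !![1, 0; 1, 1]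

/-- The `m`-th Kronecker power `G^{⊗m}` of the kernel, an `2^m × 2^m` matrix over `F_2`. -/
def GPow : (m : ℕ) → Matrix (Fin (2 ^ m)) (Fin (2 ^ m)) (ZMod 2)
  | 0 => 1
  | m + 1 =>
    Matrix.reindex (finProdFinEquiv.trans (finCongr (by ring)))
      (finProdFinEquiv.trans (finCongr (by ring)))
      (Matrix.kroneckerMap (· * ·) Gmat (GPow m))

/-- The canonical joint pmf of `(V', Θ)`, where `V'` is uniform on `F_2^{2^m}` and
`Θ` is an independent i.i.d. Bernoulli(ε) erasure pattern. -/
def becPMF (m : ℕ) (ε : ℝ) : (Fin (2 ^ m) → ZMod 2) × (Fin (2 ^ m) → Bool) → ℝ :=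
  fun vθ => (1 / 2 : ℝ) ^ (2 ^ m) * ∏ j, (if vθ.2 j then ε else 1 - ε)

/-- The capacity of the `i`-th bit-channel of the polarization transform over BEC(ε):
`C_i = I(V'_i ; (Z', V'_{<i}))` where `V'` is uniform on `F_2^{2^m}` and `Z'` is the
BEC(ε) output of `V'⬝G^{⊗m}`. -/
def becBitCapacity (m : ℕ) (ε : ℝ) (i : Fin (2 ^ m)) : ℝ :=
  mutInfo (becPMF m ε) (fun vθ => vθ.1 i)
    (fun vθ =>
      ((fun j => if vθ.2 j then (none : Option (ZMod 2))
          else some (Matrix.vecMul vθ.1 (GPow m) j)),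
        fun j : Fin i.val => vθ.1 (Fin.castLE i.isLt.le j)))

lemma prob_nonneg' {Ω : Type} [Fintype Ω] {p : Ω → ℝ} (hp : ∀ ω, 0 ≤ p ω) {α : Type} (X : Ω → α)
    (x : α) : 0 ≤ prob p X x :=
  Finset.sum_nonneg fun ω _ => by split_ifs <;> simp [hp]

lemma le_prob {Ω : Type} [Fintype Ω] {p : Ω → ℝ} (hp : ∀ ω, 0 ≤ p ω) {α : Type} (X : Ω → α)
    (ω : Ω) : p ω ≤ prob p X (X ω) := by
  have := Finset.single_le_sum (f := fun ω' => if X ω' = X ω then p ω' else 0)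
    (fun ω' _ => by split_ifs <;> simp [hp]) (Finset.mem_univ ω)
  simpa [prob] using this

lemma sum_prob_mul {Ω : Type} [Fintype Ω] (p : Ω → ℝ) {α : Type} [Fintype α] (X : Ω → α)
    (g : α → ℝ) : ∑ x, prob p X x * g x = ∑ ω, p ω * g (X ω) := by
  simp only [prob, Finset.sum_mul]
  rw [Finset.sum_comm]
  refine Finset.sum_congr rfl fun ω _ => ?_
  simp [ite_mul]

lemma prob_comp {Ω : Type} [Fintype Ω] (p : Ω → ℝ) {α β : Type} [Fintype α] (X : Ω → α)
    (f : α → β) (y : β) :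
    prob p (fun ω => f (X ω)) y = ∑ x, prob p X x * (if f x = y then 1 else 0) := by
  rw [sum_prob_mul]
  simp [prob]

lemma sum_prob {Ω : Type} [Fintype Ω] (p : Ω → ℝ) {α : Type} [Fintype α] (X : Ω → α) :
    ∑ x, prob p X x = ∑ ω, p ω := by
  simpa using sum_prob_mul p X (fun _ => 1)

lemma entropy_eq {Ω : Type} [Fintype Ω] (p : Ω → ℝ) {α : Type} [Fintype α] (X : Ω → α) :
    entropy p X = -∑ ω, p ω * Real.logb 2 (prob p X (X ω)) := by
  rw [entropy, sum_prob_mul p X (fun x => Real.logb 2 (prob p X x))]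

lemma entropy_le {Ω : Type} [Fintype Ω] {p : Ω → ℝ} (hp : ∀ ω, 0 ≤ p ω) {α β : Type} [Fintype α]
    [Fintype β] (X : Ω → α) (Y : Ω → β) (h : ∀ ω ω', X ω = X ω' → Y ω = Y ω') :
    entropy p Y ≤ entropy p X := by
  rw [entropy_eq, entropy_eq, neg_le_neg_iff]
  refine Finset.sum_le_sum fun ω _ => ?_
  rcases (hp ω).eq_or_lt with h0 | h0
  · simp [← h0]
  · refine mul_le_mul_of_nonneg_left ?_ (hp ω)
    refine Real.logb_le_logb_of_le (by norm_num) (h0.trans_le (le_prob hp X ω)) ?_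
    refine Finset.sum_le_sum fun ω' _ => ?_
    by_cases hx : X ω' = X ω
    · simp [hx, h _ _ hx]
    · rw [if_neg hx]; split_ifs <;> simp [hp]

lemma entropy_congr {Ω : Type} [Fintype Ω] {p : Ω → ℝ} (hp : ∀ ω, 0 ≤ p ω) {α β : Type} [Fintype α]
    [Fintype β] (X : Ω → α) (Y : Ω → β) (h : ∀ ω ω', X ω = X ω' ↔ Y ω = Y ω') :
    entropy p Y = entropy p X :=
  le_antisymm (entropy_le hp _ _ fun _ _ => (h _ _).1) (entropy_le hp _ _ fun _ _ => (h _ _).2)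

lemma entropy_transfer {Ω Ω' : Type} [Fintype Ω] [Fintype Ω'] {p : Ω → ℝ} {q : Ω' → ℝ}
    (X : Ω → Ω') (hX : ∀ y, prob p X y = q y) {β : Type} [Fintype β] (f : Ω' → β) :
    entropy p (fun ω => f (X ω)) = entropy q f := by
  have : ∀ z, prob p (fun ω => f (X ω)) z = prob q f z := by
    intro z
    rw [prob_comp]
    simp only [hX]
    simp [prob]
  simp [entropy, this]

lemma entropy_uniform {Ω : Type} [Fintype Ω] {p : Ω → ℝ} (hp : IsPMF p) {α : Type} [Fintype α]
    (X : Ω → α) (k : ℕ) (h : ∀ x, prob p X x = (1 / 2 : ℝ) ^ k) : entropy p X = k := by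
  rw [entropy_eq]
  simp only [h]
  rw [← Finset.sum_mul, hp.2]
  simp [Real.logb_pow, Real.logb_inv]

lemma prob_marg {Ω : Type} [Fintype Ω] (p : Ω → ℝ) {α β : Type} [Fintype α] (X : Ω → α)
    (Y : Ω → β) (y : β) : ∑ x, prob p (fun ω => (X ω, Y ω)) (x, y) = prob p Y y := by
  simp only [prob]
  rw [Finset.sum_comm]
  refine Finset.sum_congr rfl fun ω _ => ?_
  by_cases h : Y ω = y <;> simp [h]

lemma prob_marg_snd {Ω : Type} [Fintype Ω] (p : Ω → ℝ) {α β : Type} [Fintype β] (X : Ω → α)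
    (Y : Ω → β) (x : α) : ∑ y, prob p (fun ω => (X ω, Y ω)) (x, y) = prob p X x := by
  simp only [prob]
  rw [Finset.sum_comm]
  refine Finset.sum_congr rfl fun ω _ => ?_
  by_cases h : X ω = x <;> simp [h]

lemma submod {Ω : Type} [Fintype Ω] {p : Ω → ℝ} (hp : IsPMF p) {α β γ : Type}
    [Fintype α] [Fintype β] [Fintype γ] (X : Ω → α) (Y : Ω → β) (W : Ω → γ) :
    entropy p (fun ω => (X ω, Y ω, W ω)) + entropy p W ≤
      entropy p (fun ω => (X ω, W ω)) + entropy p (fun ω => (Y ω, W ω)) := by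
  obtain ⟨h0, h1⟩ := hp
  set a := prob p (fun ω => (X ω, W ω)) with ha
  set b := prob p (fun ω => (Y ω, W ω)) with hb
  set c := prob p (fun ω => (X ω, Y ω, W ω)) with hc
  set d := prob p W with hd
  have ha0 : ∀ x, 0 ≤ a x := prob_nonneg' h0 _
  have hb0 : ∀ x, 0 ≤ b x := prob_nonneg' h0 _
  have hc0 : ∀ x, 0 ≤ c x := prob_nonneg' h0 _
  have hd0 : ∀ x, 0 ≤ d x := prob_nonneg' h0 _
  have key : ∑ ω, p ω * (a (X ω, W ω) * b (Y ω, W ω) / (c (X ω, Y ω, W ω) * d (W ω))) ≤ 1 := by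
    rw [← sum_prob_mul p (fun ω => (X ω, Y ω, W ω))
      (fun t => a (t.1, t.2.2) * b (t.2.1, t.2.2) / (c t * d t.2.2))]
    calc _ ≤ ∑ t : α × β × γ, a (t.1, t.2.2) * b (t.2.1, t.2.2) / d t.2.2 := by
          refine Finset.sum_le_sum fun t _ => ?_
          rw [← hc]
          rcases (hc0 t).eq_or_lt with h | h
          · rw [← h, zero_mul]
            exact div_nonneg (mul_nonneg (ha0 _) (hb0 _)) (hd0 _)
          · apply le_of_eq
            rw [mul_div_assoc', mul_div_mul_left _ _ h.ne']
      _ = ∑ w, d w := by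
          rw [Fintype.sum_prod_type]
          simp only [Fintype.sum_prod_type]
          rw [Finset.sum_congr rfl fun x _ => Finset.sum_comm, Finset.sum_comm]
          refine Finset.sum_congr rfl fun w _ => ?_
          simp only [← Finset.sum_div, ← Finset.mul_sum, ← Finset.sum_mul]
          rw [ha, hb, prob_marg, prob_marg, ← hd]
          by_cases h : d w = 0
          · simp [h]
          · field_simp
      _ = 1 := by rw [hd, sum_prob, h1]
  have h2 : ∑ ω, p ω * (Real.logb 2 (a (X ω, W ω)) + Real.logb 2 (b (Y ω, W ω))
      - Real.logb 2 (c (X ω, Y ω, W ω)) - Real.logb 2 (d (W ω))) ≤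
      ∑ ω, p ω * ((a (X ω, W ω) * b (Y ω, W ω) / (c (X ω, Y ω, W ω) * d (W ω)) - 1)
        / Real.log 2) := by
    refine Finset.sum_le_sum fun ω _ => ?_
    rcases (h0 ω).eq_or_lt with h | h
    · simp [← h]
    refine mul_le_mul_of_nonneg_left ?_ (h0 ω)
    have a1 : 0 < a (X ω, W ω) := h.trans_le (le_prob h0 (fun ω => (X ω, W ω)) ω)
    have b1 : 0 < b (Y ω, W ω) := h.trans_le (le_prob h0 (fun ω => (Y ω, W ω)) ω)
    have c1 : 0 < c (X ω, Y ω, W ω) := h.trans_le (le_prob h0 (fun ω => (X ω, Y ω, W ω)) ω)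
    have d1 : 0 < d (W ω) := h.trans_le (le_prob h0 W ω)
    have := Real.log_le_sub_one_of_pos (div_pos (mul_pos a1 b1) (mul_pos c1 d1))
    rw [Real.log_div (by positivity) (by positivity), Real.log_mul a1.ne' b1.ne',
      Real.log_mul c1.ne' d1.ne'] at this
    simp only [Real.logb, ← add_div, ← sub_div]
    refine div_le_div_of_nonneg_right ?_ (Real.log_nonneg (by norm_num))
    linarith
  have h3 : ∑ ω, p ω * ((a (X ω, W ω) * b (Y ω, W ω) / (c (X ω, Y ω, W ω) * d (W ω)) - 1)
        / Real.log 2) ≤ 0 := by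
    simp only [mul_div_assoc' _ _ (Real.log 2), ← Finset.sum_div, mul_sub, mul_one, Finset.sum_sub_distrib, h1]
    exact div_nonpos_of_nonpos_of_nonneg (by linarith) (Real.log_nonneg (by norm_num))
  rw [entropy_eq, entropy_eq, entropy_eq, entropy_eq]
  simp only [mul_add, mul_sub, Finset.sum_add_distrib, Finset.sum_sub_distrib] at h2
  linarith

def zOut (m : ℕ) (v : Fin (2 ^ m) → ZMod 2) (θ : Fin (2 ^ m) → Bool) :
    Fin (2 ^ m) → Option (ZMod 2) :=
  fun j => if θ j then none else some (Matrix.vecMul v (GPow m) j)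

def hS (m : ℕ) (ε : ℝ) (S : Finset (Fin (2 ^ m))) : ℝ :=
  entropy (becPMF m ε) (fun w => ((fun i : {i // i ∈ S} => w.1 i), zOut m w.1 w.2))

lemma bec_nonneg (m : ℕ) (ε : ℝ) (hε : ε ∈ Set.Icc (0 : ℝ) 1) (w) : 0 ≤ becPMF m ε w := by
  obtain ⟨h0, h1⟩ := hε
  refine mul_nonneg (by positivity) (Finset.prod_nonneg fun j _ => ?_)
  split_ifs <;> linarith

lemma bec_bit (m : ℕ) (ε : ℝ) (hq : IsPMF (becPMF m ε)) (i : Fin (2 ^ m)) :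
    entropy (becPMF m ε) (fun w => w.1 i) = 1 := by
  have h : ∀ x d, prob (becPMF m ε) (fun w => w.1 i) (x + d) = prob (becPMF m ε) (fun w => w.1 i) x := by
    intro x d
    unfold prob
    symm
    refine Fintype.sum_equiv ((Equiv.addRight (Pi.single i d)).prodCongr (Equiv.refl _)) _ _ ?_
    intro w
    simp [becPMF]
  have hs := sum_prob (becPMF m ε) (fun w => w.1 i)
  rw [hq.2] at hs
  have : ∀ x, prob (becPMF m ε) (fun w => w.1 i) x = (1 / 2 : ℝ) ^ 1 := by
    intro x
    have e : ∀ y, prob (becPMF m ε) (fun w => w.1 i) y = prob (becPMF m ε) (fun w => w.1 i) x := by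
      intro y
      have := h x (y - x)
      rwa [add_sub_cancel] at this
    simp only [e] at hs
    rw [Finset.sum_const, Finset.card_univ, ZMod.card] at hs
    simp at hs ⊢
    linarith
  simpa using entropy_uniform hq _ 1 this

lemma cap_eq (m : ℕ) (ε : ℝ) (hq : IsPMF (becPMF m ε)) (i : Fin (2 ^ m)) :
    becBitCapacity m ε i = 1 + hS m ε (Finset.Iio i) - hS m ε (Finset.Iic i) := by
  unfold becBitCapacity mutInfo hS
  rw [bec_bit m ε hq]
  have key : ∀ w w' : (Fin (2 ^ m) → ZMod 2) × (Fin (2 ^ m) → Bool),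
      ((fun j : Fin i.val => w.1 (Fin.castLE i.isLt.le j)) =
        (fun j : Fin i.val => w'.1 (Fin.castLE i.isLt.le j))) ↔ ∀ j < i, w.1 j = w'.1 j := by
    intro w w'
    rw [funext_iff]
    constructor
    · intro h j hj
      exact h ⟨j.val, hj⟩
    · intro h j
      exact h _ j.isLt
  congr 1
  · congr 1
    refine entropy_congr hq.1 _ _ fun w w' => ?_
    rw [Prod.mk.injEq, Prod.mk.injEq, key, funext_iff]
    simp only [Subtype.forall, Finset.mem_Iio]
    exact and_comm
  · refine entropy_congr hq.1 _ _ fun w w' => ?_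
    rw [Prod.mk.injEq, Prod.mk.injEq, Prod.mk.injEq, key, funext_iff]
    simp only [Subtype.forall, Finset.mem_Iic, le_iff_lt_or_eq]
    constructor
    · rintro ⟨h, hz⟩
      exact ⟨h _ (Or.inr rfl), hz, fun j hj => h _ (Or.inl hj)⟩
    · rintro ⟨h, hz, hj⟩
      refine ⟨?_, hz⟩
      rintro j (h' | rfl)
      · exact hj _ h'
      · exact h

lemma chain (m : ℕ) (ε : ℝ) (hq : IsPMF (becPMF m ε)) (S : Finset (Fin (2 ^ m))) :
    (S.card : ℝ) + hS m ε ∅ - hS m ε S ≤ ∑ i ∈ S, becBitCapacity m ε i := by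
  induction S using Finset.induction_on_max with
  | empty => simp
  | insert a S hlt ih =>
    have ha : a ∉ S := fun h => lt_irrefl _ (hlt a h)
    rw [Finset.sum_insert ha, Finset.card_insert_of_notMem ha, cap_eq m ε hq]
    have := submod hq (fun w => w.1 a) (fun w => fun i : {i // i ∈ Finset.Iio a} => w.1 i)
      (fun w => ((fun i : {i // i ∈ S} => w.1 i), zOut m w.1 w.2))
    have e1 : entropy (becPMF m ε) (fun w => (w.1 a, ((fun i : {i // i ∈ Finset.Iio a} => w.1 i),
      ((fun i : {i // i ∈ S} => w.1 i), zOut m w.1 w.2)))) = hS m ε (Finset.Iic a) := by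
      refine entropy_congr hq.1 _ _ fun w w' => ?_
      simp only [Prod.mk.injEq, funext_iff (β := fun _ => ZMod 2), Subtype.forall,
        Finset.mem_Iio, Finset.mem_Iic]
      constructor
      · rintro ⟨h, hz⟩
        exact ⟨h _ le_rfl, fun j hj => h _ hj.le, fun j hj => h _ (hlt _ hj).le, hz⟩
      · rintro ⟨h, h1, h2, hz⟩
        refine ⟨fun j hj => ?_, hz⟩
        rcases hj.lt_or_eq with h' | rfl
        · exact h1 _ h'
        · exact h
    have e2 : entropy (becPMF m ε) (fun w => (w.1 a, 
      ((fun i : {i // i ∈ S} => w.1 i), zOut m w.1 w.2))) = hS m ε (insert a S) := by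
      refine entropy_congr hq.1 _ _ fun w w' => ?_
      simp only [Prod.mk.injEq, funext_iff (β := fun _ => ZMod 2), Subtype.forall,
        Finset.forall_mem_insert, and_assoc]
    have e3 : entropy (becPMF m ε) (fun w => ((fun i : {i // i ∈ Finset.Iio a} => w.1 i), 
      ((fun i : {i // i ∈ S} => w.1 i), zOut m w.1 w.2))) = hS m ε (Finset.Iio a) := by
      refine entropy_congr hq.1 _ _ fun w w' => ?_
      simp only [Prod.mk.injEq, funext_iff (β := fun _ => ZMod 2), Subtype.forall,
        Finset.mem_Iio]
      constructor
      · rintro ⟨h, hz⟩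
        exact ⟨h, fun j hj => h _ (hlt _ hj), hz⟩
      · rintro ⟨h, h1, hz⟩
        exact ⟨h, hz⟩
    rw [e1, e2, e3] at this
    change _ + hS m ε S ≤ _ at this
    push_cast
    linarith

lemma subadd {Ω : Type} [Fintype Ω] {p : Ω → ℝ} (hp : IsPMF p) {α β : Type}
    [Fintype α] [Fintype β] (X : Ω → α) (Y : Ω → β) :
    entropy p (fun ω => (X ω, Y ω)) ≤ entropy p X + entropy p Y := by
  have := submod hp X Y (fun _ => ())
  have e0 : entropy p (fun _ => ()) = 0 := by
    rw [entropy_eq]; simp [prob, hp.2]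
  rw [e0, entropy_congr hp.1 (fun ω => (X ω, Y ω)) (fun ω => (X ω, Y ω, ())) (by simp),
    entropy_congr hp.1 X (fun ω => (X ω, ())) (by simp),
    entropy_congr hp.1 Y (fun ω => (Y ω, ())) (by simp)] at this
  linarith

def extPMF {Ω : Type} (p : Ω → ℝ) {β : Type} (k : ℕ) : Ω × (β → ZMod 2) → ℝ :=
  fun w => p w.1 * (1 / 2 : ℝ) ^ k

section
variable {Ω : Type} [Fintype Ω] {p : Ω → ℝ} (hp : IsPMF p) {β : Type} [Fintype β] [DecidableEq β]
include hp

lemma ext_pmf : IsPMF (extPMF p (β := β) (Fintype.card β)) := by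
  refine ⟨fun w => mul_nonneg (hp.1 _) (by positivity), ?_⟩
  simp only [extPMF, Fintype.sum_prod_type, Finset.sum_const, ← Finset.smul_sum, ← Finset.sum_mul,
    hp.2]
  simp [ZMod.card]

lemma ext_entropy {α : Type} [Fintype α] (X : Ω → α) :
    entropy (extPMF p (β := β) (Fintype.card β)) (fun w => (X w.1, w.2))
      = entropy p X + Fintype.card β := by
  have hpr : ∀ x b, prob (extPMF p (β := β) (Fintype.card β)) (fun w => (X w.1, w.2)) (x, b)
      = prob p X x * (1 / 2 : ℝ) ^ (Fintype.card β) := by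
    intro x b
    simp only [prob, extPMF, Fintype.sum_prod_type, Finset.sum_mul]
    refine Finset.sum_congr rfl fun ω _ => ?_
    by_cases h : X ω = x <;> simp [h]
  rw [entropy_eq, entropy_eq]
  simp only [hpr]
  simp only [Fintype.sum_prod_type, extPMF]
  simp only [Finset.sum_const, Finset.card_univ, Fintype.card_fun, ZMod.card]
  have : ∀ ω, (2 ^ Fintype.card β) • (p ω * (1 / 2 : ℝ) ^ Fintype.card β *
      Real.logb 2 (prob p X (X ω) * (1 / 2 : ℝ) ^ Fintype.card β)) =
      p ω * Real.logb 2 (prob p X (X ω)) - p ω * Fintype.card β := by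
    intro ω
    rcases (hp.1 ω).eq_or_lt with h | h
    · simp [← h]
    · rw [Real.logb_mul (h.trans_le (le_prob hp.1 X ω)).ne' (by positivity), Real.logb_pow]
      simp [Real.logb_inv]
      field_simp
      ring
  simp only [this, Finset.sum_sub_distrib, ← Finset.sum_mul, hp.2]
  ring

lemma ext_snd : entropy (extPMF p (β := β) (Fintype.card β)) (fun w => w.2) = Fintype.card β := by
  have h := ext_entropy hp (β := β) (fun _ => ())
  have e0 : entropy p (fun _ => ()) = 0 := by
    rw [entropy_eq]; simp [prob, hp.2]
  rw [e0, zero_add] at h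
  rw [← h]
  refine entropy_congr (ext_pmf hp).1 (fun w => ((), w.2)) (fun w => w.2) fun w w' => ?_
  rw [Prod.mk.injEq]
  exact ⟨fun h => h.2, fun h => ⟨rfl, h⟩⟩

lemma ext_pmf' (k : ℕ) (hk : Fintype.card β = k) : IsPMF (extPMF p (β := β) k) := by
  subst hk
  exact ext_pmf hp

lemma ext_entropy' (k : ℕ) (hk : Fintype.card β = k) {α : Type} [Fintype α] (X : Ω → α) :
    entropy (extPMF p (β := β) k) (fun w => (X w.1, w.2)) = entropy p X + k := by
  subst hk
  exact ext_entropy hp X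

lemma ext_snd' (k : ℕ) (hk : Fintype.card β = k) :
    entropy (extPMF p (β := β) k) (fun w => w.2) = k := by
  subst hk
  exact ext_snd hp

end

set_option maxHeartbeats 200000

/-- **Proposition 1** instantiated for a wiretap BEC: in the polar-secrecy-code-over-BEC
setup, the MIS leakage satisfies `I(U ; Z) ≤ min (∑_{i∈A∪B} C_i) k`. -/
theorem stmt7 {Ω : Type} [Fintype Ω] (p : Ω → ℝ) (hp : IsPMF p)
    (m : ℕ) (ε : ℝ) (hε : ε ∈ Set.Icc (0 : ℝ) 1)
    (A R B : Finset (Fin (2 ^ m)))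
    (hAR : Disjoint A R) (hAB : Disjoint A B) (hRB : Disjoint R B)
    (hcover : A ∪ R ∪ B = Finset.univ)
    (U : Ω → ({i // i ∈ A} → ZMod 2)) (E : Ω → ({i // i ∈ R} → ZMod 2))
    (Θ : Ω → (Fin (2 ^ m) → Bool))
    (hUE : ∀ u e, prob p (fun ω => (U ω, E ω)) (u, e) = (1 / 2 : ℝ) ^ (A.card + R.card))
    (hΘ : ∀ u e θ, prob p (fun ω => ((U ω, E ω), Θ ω)) ((u, e), θ)
      = prob p (fun ω => (U ω, E ω)) (u, e) * ∏ j, (if θ j then ε else 1 - ε))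
    (V : Ω → (Fin (2 ^ m) → ZMod 2))
    (hV : ∀ ω i, V ω i
      = if h : i ∈ A then U ω ⟨i, h⟩ else if h : i ∈ R then E ω ⟨i, h⟩ else 0)
    (Z : Ω → (Fin (2 ^ m) → Option (ZMod 2)))
    (hZ : ∀ ω j, Z ω j = if Θ ω j then none
      else some (Matrix.vecMul (V ω) (GPow m) j)) :
    mutInfo p U Z ≤ min (∑ i ∈ A ∪ B, becBitCapacity m ε i) (A.card : ℝ) := by
  have hcard : A.card + R.card + B.card = 2 ^ m := by
    rw [← Finset.card_union_of_disjoint hAR, ← Finset.card_union_of_disjoint, hcover]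
    · simp
    · exact Finset.disjoint_union_left.2 ⟨hAB, hRB⟩
  have hU : ∀ u, prob p U u = (1 / 2 : ℝ) ^ A.card := by
    intro u
    rw [← prob_marg_snd p U E u]
    simp only [hUE, Finset.sum_const, Finset.card_univ, Fintype.card_fun, ZMod.card,
      Fintype.card_coe]
    simp [pow_add]
    field_simp
  have hHU : entropy p U = A.card := entropy_uniform hp U _ hU
  refine le_min ?_ ?_
  swap
  · have := entropy_le hp.1 (fun ω => (U ω, Z ω)) Z (by simp)
    unfold mutInfo
    linarith
  have hcB : Fintype.card {i // i ∈ B} = B.card := by simp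
  obtain ⟨p', hp'⟩ : ∃ q : Ω × ({i // i ∈ B} → ZMod 2) → ℝ, q = extPMF p B.card := ⟨_, rfl⟩
  have hP' : IsPMF p' := by
    rw [hp']
    exact ext_pmf' hp _ hcB
  obtain ⟨V', hV'⟩ : ∃ V' : Ω × ({i // i ∈ B} → ZMod 2) → (Fin (2 ^ m) → ZMod 2),
    ∀ w i, V' w i = if h : i ∈ B then w.2 ⟨i, h⟩ else V w.1 i := ⟨fun w i =>
    if h : i ∈ B then w.2 ⟨i, h⟩ else V w.1 i, fun _ _ => rfl⟩
  have hVA : ∀ w (i) (hi : i ∈ A), V' w i = U w.1 ⟨i, hi⟩ := by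
    intro w i hi
    have : i ∉ B := Finset.disjoint_left.1 hAB hi
    simp [hV', this, hV, hi]
  have hVR : ∀ w (i) (hi : i ∈ R), V' w i = E w.1 ⟨i, hi⟩ := by
    intro w i hi
    have : i ∉ B := Finset.disjoint_left.1 hRB hi
    have h2 : i ∉ A := Finset.disjoint_right.1 hAR hi
    simp [hV', this, hV, hi, h2]
  have hVB : ∀ w (i) (hi : i ∈ B), V' w i = w.2 ⟨i, hi⟩ := by
    intro w i hi
    simp [hV', hi]
  have hor : ∀ i, i ∈ A ∨ i ∈ R ∨ i ∈ B := by
    intro i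
    have : i ∈ A ∪ R ∪ B := by rw [hcover]; simp
    simpa [or_assoc] using this
  have hprob : ∀ y, prob p' (fun w => (V' w, Θ w.1)) y = becPMF m ε y := by
    rintro ⟨v, θ⟩
    have hiff : ∀ w, (V' w, Θ w.1) = (v, θ) ↔
        w.2 = (fun i => v i.1) ∧ ((U w.1, E w.1), Θ w.1) = (((fun i => v i.1), (fun i => v i.1)), θ) := by
      intro w
      simp only [Prod.mk.injEq]
      constructor
      · rintro ⟨rfl, h⟩
        refine ⟨funext fun i => (hVB w i.1 i.2).symm, ⟨funext fun i => (hVA w i.1 i.2).symm,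
          funext fun i => (hVR w i.1 i.2).symm⟩, h⟩
      · rintro ⟨h1, ⟨h2, h3⟩, h4⟩
        refine ⟨funext fun i => ?_, h4⟩
        rcases hor i with hi | hi | hi
        · rw [hVA w i hi, h2]
        · rw [hVR w i hi, h3]
        · rw [hVB w i hi, h1]
    have := hΘ (fun i => v i.1) (fun i => v i.1) θ
    rw [hUE] at this
    unfold prob at this ⊢
    simp only [hiff, Fintype.sum_prod_type, hp', extPMF, ite_and]
    simp only [Finset.sum_ite_eq', Finset.sum_ite_eq, Finset.mem_univ, if_true]
    have e2 : ∀ ω, (if ((U ω, E ω), Θ ω) = (((fun i => v i.1), (fun i => v i.1)), θ) then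
        p ω * (1 / 2 : ℝ) ^ B.card else 0) =
        (if ((U ω, E ω), Θ ω) = (((fun i => v i.1), (fun i => v i.1)), θ) then p ω else 0)
          * (1 / 2 : ℝ) ^ B.card := by
      intro ω; split_ifs <;> simp
    simp only [e2, ← Finset.sum_mul]
    have hpw : (1 / 2 : ℝ) ^ (2 ^ m) = (1 / 2 : ℝ) ^ (A.card + R.card) * (1 / 2 : ℝ) ^ B.card := by
      rw [← pow_add, hcard]
    have e5 := congrArg (fun t : ℝ => t * (1 / 2 : ℝ) ^ B.card) this
    refine Eq.trans ?_ (e5.trans ?_)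
    · dsimp only
      congr!
    · dsimp only [becPMF]
      rw [hpw]
      ring
  have hq : IsPMF (becPMF m ε) := by
    refine ⟨bec_nonneg m ε hε, ?_⟩
    simp only [← hprob]
    rw [sum_prob]
    exact hP'.2
  have hchain := chain m ε hq (A ∪ B)
  rw [Finset.card_union_of_disjoint hAB] at hchain
  -- entropies
  have hh : ∀ S, hS m ε S = entropy p' (fun w => ((fun i : {i // i ∈ S} => V' w i),
      zOut m (V' w) (Θ w.1))) := by
    intro S
    exact (entropy_transfer (p := p') (q := becPMF m ε) (fun w => (V' w, Θ w.1)) hprob _).symm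
  have hlin : ∀ w j, Matrix.vecMul (V' w) (GPow m) j = Matrix.vecMul (V w.1) (GPow m) j +
      Matrix.vecMul (fun i => if h : i ∈ B then w.2 ⟨i, h⟩ else 0) (GPow m) j := by
    intro w j
    rw [← Pi.add_apply, ← Matrix.add_vecMul]
    congr 2
    funext i
    by_cases hi : i ∈ B
    · have h1 : i ∉ A := Finset.disjoint_right.1 hAB hi
      have h2 : i ∉ R := Finset.disjoint_right.1 hRB hi
      simp [hV', hi, hV, h1, h2]
    · simp [hV', hi]
  have hZZ : ∀ w w' : Ω × ({i // i ∈ B} → ZMod 2), w.2 = w'.2 →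
      (Z w.1 = Z w'.1 ↔ zOut m (V' w) (Θ w.1) = zOut m (V' w') (Θ w'.1)) := by
    intro w w' hb
    rw [funext_iff, funext_iff]
    refine forall_congr' fun j => ?_
    simp only [hZ, zOut, hlin, hb]
    split_ifs <;> simp
  have e1 : entropy p' (fun w => (zOut m (V' w) (Θ w.1), w.2)) = entropy p Z + B.card := by
    rw [← ext_entropy' hp _ hcB Z, ← hp']
    refine entropy_congr hP'.1 _ _ fun w w' => ?_
    simp only [Prod.mk.injEq]
    constructor
    · rintro ⟨h, hb⟩; exact ⟨(hZZ w w' hb).1 h, hb⟩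
    · rintro ⟨h, hb⟩; exact ⟨(hZZ w w' hb).2 h, hb⟩
  have e2 : hS m ε (A ∪ B) = entropy p (fun ω => (U ω, Z ω)) + B.card := by
    rw [hh, ← ext_entropy' hp _ hcB (fun ω => (U ω, Z ω)), ← hp']
    refine entropy_congr hP'.1 _ _ fun w w' => ?_
    simp only [Prod.mk.injEq]
    constructor
    · rintro ⟨⟨hu, h⟩, hb⟩
      refine ⟨funext ?_, (hZZ w w' hb).1 h⟩
      rintro ⟨i, hi⟩
      rcases Finset.mem_union.1 hi with hi | hi
      · simp only [hVA _ i hi, hu]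
      · simp only [hVB _ i hi, hb]
    · rintro ⟨hv, h⟩
      have hb : w.2 = w'.2 := by
        funext i
        have := congrFun hv ⟨i.1, Finset.mem_union_right _ i.2⟩
        simpa only [hVB _ i.1 i.2] using this
      refine ⟨⟨?_, (hZZ w w' hb).2 h⟩, hb⟩
      funext i
      have := congrFun hv ⟨i.1, Finset.mem_union_left _ i.2⟩
      simpa only [hVA _ i.1 i.2] using this
  have e3 : hS m ε ∅ = entropy p' (fun w => zOut m (V' w) (Θ w.1)) := by
    rw [hh]
    refine entropy_congr hP'.1 _ _ fun w w' => ?_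
    simp only [Prod.mk.injEq]
    refine ⟨fun h => ⟨funext fun i => ?_, h⟩, fun h => h.2⟩
    exact absurd i.2 (Finset.notMem_empty _)
  have e4 : entropy p' (fun w => w.2) = B.card := by
    rw [hp']
    exact ext_snd' hp _ hcB
  have h5 := subadd hP' (fun w => zOut m (V' w) (Θ w.1)) (fun w => w.2)
  rw [e1, e4, ← e3] at h5
  unfold mutInfo
  push_cast at hchain
  linarith
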